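/- (Combinatorial core of Proposition 2.2(b)) Let d ≥ 2 and let λ : {1,…,d}×{1,…,d} → ℝ be symmetric with λ_{sk} ∈ [0,1] for all s ≠ k. Then, with D = d(d−1)/2, there exist nonnegative real numbers α_j^{(i)}, i = 1,…,d, j = 1,…,D, such that (i) Σ_{j=1}^{D} α_j^{(i)} ≤ d − 1 for every i, and (ii) Σ_{j=1}^{D} min(α_j^{(s)}, α_j^{(k)}) = λ_{sk} for all s ≠ k. -/

import Mathlib

/-- Combinatorial core of Proposition 2.2(b): Let `d ≥ 2` and let
`λ : Fin d × Fin d → ℝ` be symmetric with off-diagonal entries in `[0,1]`. Then, with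
`D = d(d−1)/2`, there exist nonnegative reals `α_j^{(i)}` such that
(i) `Σ_j α_j^{(i)} ≤ d − 1` for every `i`, and
(ii) `Σ_j min(α_j^{(s)}, α_j^{(k)}) = λ_{sk}` for all `s ≠ k`. -/
theorem stmt_9
    (d : ℕ) (hd : 2 ≤ d)
    (lam : Fin d → Fin d → ℝ)
    (hsymm : ∀ s k, lam s k = lam k s)
    (hrange : ∀ s k, s ≠ k → lam s k ∈ Set.Icc (0 : ℝ) 1) :
    ∃ α : Fin d → Fin (d * (d - 1) / 2) → ℝ,
      (∀ i j, 0 ≤ α i j) ∧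
      (∀ i, ∑ j, α i j ≤ (d : ℝ) - 1) ∧
      (∀ s k, s ≠ k → ∑ j, min (α s j) (α k j) = lam s k) := by
  classical
  have hcard : Fintype.card {e : Sym2 (Fin d) // ¬ e.IsDiag} = d * (d - 1) / 2 := by
    rw [Sym2.card_subtype_not_diag, Fintype.card_fin, Nat.choose_two_right]
  let φ := (Fintype.equivFinOfCardEq hcard).symm
  let w : Sym2 (Fin d) → ℝ := Sym2.lift ⟨lam, hsymm⟩
  have hw : ∀ e : Sym2 (Fin d), ¬ e.IsDiag → w e ∈ Set.Icc (0 : ℝ) 1 := by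
    intro e
    induction e with
    | _ s k => exact fun h => hrange s k (by simpa using h)
  let α (i : Fin d) (e : {e : Sym2 (Fin d) // ¬ e.IsDiag}) : ℝ := if i ∈ e.1 then w e.1 else 0
  have hα : ∀ i e, 0 ≤ α i e := fun i e => by
    dsimp only [α]
    split_ifs
    exacts [(hw e.1 e.2).1, le_rfl]
  refine ⟨fun i j => α i (φ j), fun i j => hα i (φ j), fun i => ?_, fun s k hsk => ?_⟩
  · rw [φ.sum_comp (α i)]
    calc ∑ e, α i e
        ≤ ∑ e : {e : Sym2 (Fin d) // ¬ e.IsDiag},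
            ∑ k ∈ Finset.univ.erase i, if e.1 = s(i, k) then (1 : ℝ) else 0 := by
          refine Finset.sum_le_sum fun e _ => ?_
          have hnn : ∀ k ∈ Finset.univ.erase i, (0 : ℝ) ≤ if e.1 = s(i, k) then 1 else 0 :=
            fun k _ => by positivity
          by_cases hi : i ∈ e.1
          · obtain ⟨k, hk⟩ := hi
            have hki : k ≠ i := by
              rintro rfl
              exact e.2 (by simp [hk])
            refine le_trans ?_ (Finset.single_le_sum hnn (by simp [hki] : k ∈ _))
            rw [if_pos hk]
            dsimp only [α]
            split_ifs
            exacts [(hw e.1 e.2).2, zero_le_one]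
          · rw [show α i e = 0 from if_neg hi]
            exact Finset.sum_nonneg hnn
      _ = ∑ k ∈ Finset.univ.erase i, (1 : ℝ) := by
          rw [Finset.sum_comm]
          refine Finset.sum_congr rfl fun k hk => ?_
          have hki : i ≠ k := (Finset.ne_of_mem_erase hk).symm
          rw [Finset.sum_eq_single (⟨s(i, k), by simpa using hki⟩ :
            {e : Sym2 (Fin d) // ¬ e.IsDiag})]
          · simp
          · exact fun e _ he => if_neg fun h => he (Subtype.ext h)
          · simp
      _ = (d : ℝ) - 1 := by
          simp [Finset.card_erase_of_mem, Nat.cast_sub (by lia : 1 ≤ d)]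
  · rw [φ.sum_comp (fun e => min (α s e) (α k e)),
      Finset.sum_eq_single (⟨s(s, k), by simpa using hsk⟩ : {e : Sym2 (Fin d) // ¬ e.IsDiag})]
    · simp [α, w]
    · intro e _ he
      by_cases hs : s ∈ e.1
      · have hk : k ∉ e.1 := fun hk =>
          he (Subtype.ext ((Sym2.mem_and_mem_iff hsk).1 ⟨hs, hk⟩))
        rw [show α k e = 0 from if_neg hk, min_eq_right (hα s e)]
      · rw [show α s e = 0 from if_neg hs, min_eq_left (hα k e)]
    · simp
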